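/- Let X ∈ ℂ^{n×p} and Y ∈ ℂ^{n×q} have orthonormal columns (XᴴX = I, YᴴY = I). Let B be the Moore–Penrose pseudoinverse of XᴴY and let C be the Moore–Penrose pseudoinverse of XXᴴYYᴴ = P_X P_Y. Then (I − XXᴴ) C = (I − XXᴴ) Y B Xᴴ; that is, P_{X⊥}(P_X P_Y)† = P_{X⊥} Y (XᴴY)† Xᴴ. -/

import Mathlib

open scoped Matrix

/-- `B` is the Moore–Penrose pseudoinverse of `A`. -/
def IsMoorePenrose {m n : ℕ} (A : Matrix (Fin m) (Fin n) ℂ)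
    (B : Matrix (Fin n) (Fin m) ℂ) : Prop :=
  A * B * A = A ∧ B * A * B = B ∧ (A * B)ᴴ = A * B ∧ (B * A)ᴴ = B * A

theorem IsMoorePenrose_unique {m n : ℕ} {A : Matrix (Fin m) (Fin n) ℂ}
    {B C : Matrix (Fin n) (Fin m) ℂ} (hB : IsMoorePenrose A B) (hC : IsMoorePenrose A C) :
    B = C := by
  obtain ⟨b1, b2, b3, b4⟩ := hB
  obtain ⟨c1, c2, c3, c4⟩ := hC
  have h1 : A * B = A * C := by
    calc A * B = (A * B)ᴴ := b3.symm
      _ = ((A * C) * (A * B))ᴴ := by rw [← Matrix.mul_assoc (A * C), c1]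
      _ = (A * B) * (A * C) := by rw [Matrix.conjTranspose_mul, b3, c3]
      _ = A * C := by rw [← Matrix.mul_assoc, b1]
  have h2 : B * A = C * A := by
    calc B * A = (B * A)ᴴ := b4.symm
      _ = ((B * A) * (C * A))ᴴ := by
        rw [Matrix.mul_assoc B A (C * A), ← Matrix.mul_assoc A C A, c1]
      _ = (C * A) * (B * A) := by rw [Matrix.conjTranspose_mul, b4, c4]
      _ = C * A := by rw [Matrix.mul_assoc C A (B * A), ← Matrix.mul_assoc A B A, b1]
  calc B = B * A * B := b2.symm
    _ = C * (A * B) := by rw [h2, Matrix.mul_assoc]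
    _ = C := by rw [h1, ← Matrix.mul_assoc, c2]

theorem projector_pinv_vs_basis_pinv
    (n p q : ℕ)
    (X : Matrix (Fin n) (Fin p) ℂ) (hX : Xᴴ * X = 1)
    (Y : Matrix (Fin n) (Fin q) ℂ) (hY : Yᴴ * Y = 1)
    (B : Matrix (Fin q) (Fin p) ℂ) (hB : IsMoorePenrose (Xᴴ * Y) B)
    (C : Matrix (Fin n) (Fin n) ℂ) (hC : IsMoorePenrose (X * Xᴴ * Y * Yᴴ) C) :
    (1 - X * Xᴴ) * C = (1 - X * Xᴴ) * (Y * B * Xᴴ) := by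
  have key : IsMoorePenrose (X * Xᴴ * Y * Yᴴ) (Y * B * Xᴴ) := by
    obtain ⟨b1, b2, b3, b4⟩ := hB
    have e1 : X * Xᴴ * Y * Yᴴ * (Y * B * Xᴴ) = X * (Xᴴ * Y * B) * Xᴴ := by
      calc _ = X * Xᴴ * Y * (Yᴴ * Y) * B * Xᴴ := by simp only [Matrix.mul_assoc]
        _ = _ := by rw [hY]; simp only [Matrix.mul_assoc, Matrix.one_mul]
    have e2 : Y * B * Xᴴ * (X * Xᴴ * Y * Yᴴ) = Y * (B * (Xᴴ * Y)) * Yᴴ := by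
      calc _ = Y * B * (Xᴴ * X) * Xᴴ * Y * Yᴴ := by simp only [Matrix.mul_assoc]
        _ = _ := by rw [hX]; simp only [Matrix.mul_assoc, Matrix.one_mul]
    refine ⟨?_, ?_, ?_, ?_⟩
    · rw [e1]
      calc _ = X * (Xᴴ * Y * B) * (Xᴴ * X) * (Xᴴ * Y) * Yᴴ := by simp only [Matrix.mul_assoc]
        _ = X * (Xᴴ * Y * B * (Xᴴ * Y)) * Yᴴ := by
          rw [hX]; simp only [Matrix.mul_assoc, Matrix.one_mul]
        _ = _ := by rw [b1]; simp only [Matrix.mul_assoc]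
    · rw [e2]
      calc _ = Y * (B * (Xᴴ * Y)) * (Yᴴ * Y) * B * Xᴴ := by simp only [Matrix.mul_assoc]
        _ = Y * (B * (Xᴴ * Y) * B) * Xᴴ := by
          rw [hY]; simp only [Matrix.mul_assoc, Matrix.one_mul]
        _ = _ := by rw [b2]
    · rw [e1, Matrix.conjTranspose_mul, Matrix.conjTranspose_mul, b3,
        Matrix.conjTranspose_conjTranspose, Matrix.mul_assoc X]
    · rw [e2, Matrix.conjTranspose_mul, Matrix.conjTranspose_mul, b4,
        Matrix.conjTranspose_conjTranspose, Matrix.mul_assoc Y]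
  rw [IsMoorePenrose_unique hC key]
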